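/- arXiv:1411.5871 — 2 statements merged into one kernel-verified Lean document; each statement's English description precedes it below -/
import Mathlib

section
/- Let x ∈ (0,1) be irrational and let h ≠ 0 be such that x + h ∈ (0,1), and let K_h be the integer with x + h ∈ I_{K_h}(x) and x + h ∉ I_{K_h+1}(x). Then 1/(2·q_{K_h+2}(x)·q_{K_h+3}(x)) ≤ |h| ≤ 2/q_{K_h}(x)^2. Moreover, if a_k(x) = 1 for only finitely many indices k, then there exists h_0 > 0 such that for all such h with |h| ≤ h_0 one has the stronger lower bound 1/(2·q_{K_h+1}(x)·q_{K_h+2}(x)) ≤ |h|. -/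
open Real

noncomputable section

/-- The Gauss map: `T 0 = 0` and `T y = 1/y mod 1` otherwise. -/
def gauss (y : ℝ) : ℝ := if y = 0 then 0 else Int.fract y⁻¹

/-- Shifted convergent denominators: `qs x n = q_{n-1}(x)`, so `qs x 0 = q_{-1} = 0`,
`qs x 1 = q_0 = 1`, and `qs x (n+2) = a_{n+1} · qs x (n+1) + qs x n`
with `a_{n+1}(x) = ⌊1/T^n(x)⌋`. -/
def qs (x : ℝ) : ℕ → ℤ
  | 0 => 0
  | 1 => 1
  | n + 2 => ⌊(gauss^[n] x)⁻¹⌋ * qs x (n + 1) + qs x n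

/-- Shifted convergent numerators: `ps x n = p_{n-1}(x)`, so `ps x 0 = p_{-1} = 1`,
`ps x 1 = p_0 = 0`, and `ps x (n+2) = a_{n+1} · ps x (n+1) + ps x n`. -/
def ps (x : ℝ) : ℕ → ℤ
  | 0 => 1
  | 1 => 0
  | n + 2 => ⌊(gauss^[n] x)⁻¹⌋ * ps x (n + 1) + ps x n

/-- The basic interval `I_k(x)` of level `k` containing `x`: the open interval with
endpoints `p_k/q_k` (= `[0;a_1,…,a_k]`) and `(p_k+p_{k-1})/(q_k+q_{k-1})`
(= `[0;a_1,…,a_k+1]`). -/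
def Ibasic (x : ℝ) (k : ℕ) : Set ℝ :=
  Set.Ioo
    (min ((ps x (k + 1) : ℝ) / (qs x (k + 1) : ℝ))
      (((ps x (k + 1) : ℝ) + (ps x k : ℝ)) / ((qs x (k + 1) : ℝ) + (qs x k : ℝ))))
    (max ((ps x (k + 1) : ℝ) / (qs x (k + 1) : ℝ))
      (((ps x (k + 1) : ℝ) + (ps x k : ℝ)) / ((qs x (k + 1) : ℝ) + (qs x k : ℝ))))

theorem irrational_gauss_iterate {x : ℝ} (hirr : Irrational x) (n : ℕ) :
    Irrational (gauss^[n] x) := by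
  induction n with
  | zero => simpa using hirr
  | succ n ih =>
    rw [Function.iterate_succ_apply', gauss, if_neg ih.ne_zero, Int.fract]
    exact ih.inv.sub_intCast _

theorem gauss_iterate_mem_Ioo {x : ℝ} (hx : x ∈ Set.Ioo (0 : ℝ) 1) (hirr : Irrational x)
    (n : ℕ) : gauss^[n] x ∈ Set.Ioo (0 : ℝ) 1 := by
  cases n with
  | zero => simpa using hx
  | succ n =>
    have h := (irrational_gauss_iterate hirr (n + 1)).ne_zero
    rw [Function.iterate_succ_apply', gauss,
      if_neg (irrational_gauss_iterate hirr n).ne_zero] at h ⊢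
    exact ⟨lt_of_le_of_ne (Int.fract_nonneg _) h.symm, Int.fract_lt_one _⟩

theorem one_le_partialQuotient {x : ℝ} (hx : x ∈ Set.Ioo (0 : ℝ) 1) (hirr : Irrational x)
    (n : ℕ) : 1 ≤ ⌊(gauss^[n] x)⁻¹⌋ := by
  obtain ⟨h0, h1⟩ := gauss_iterate_mem_Ioo hx hirr n
  exact Int.le_floor.2 (by simpa using (one_le_inv₀ h0).2 h1.le)

theorem gauss_iterate_mul_add {x : ℝ} (hirr : Irrational x) (n : ℕ) :
    gauss^[n] x * ((⌊(gauss^[n] x)⁻¹⌋ : ℝ) + gauss^[n + 1] x) = 1 := by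
  have h := (irrational_gauss_iterate hirr n).ne_zero
  rw [Function.iterate_succ_apply', gauss, if_neg h, Int.floor_add_fract, mul_inv_cancel₀ h]

theorem qs_bounds {x : ℝ} (hx : x ∈ Set.Ioo (0 : ℝ) 1) (hirr : Irrational x) (n : ℕ) :
    0 ≤ qs x n ∧ 1 ≤ qs x (n + 1) ∧ qs x n ≤ qs x (n + 1) := by
  induction n with
  | zero => simp [qs]
  | succ n ih =>
    obtain ⟨h0, h1, h2⟩ := ih
    have ha := one_le_partialQuotient hx hirr n
    have hrec : qs x (n + 1 + 1) = ⌊(gauss^[n] x)⁻¹⌋ * qs x (n + 1) + qs x n := rfl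
    refine ⟨by lia, ?_, ?_⟩ <;> nlinarith

theorem qs_monotone {x : ℝ} (hx : x ∈ Set.Ioo (0 : ℝ) 1) (hirr : Irrational x) :
    Monotone (qs x) :=
  monotone_nat_of_le_succ fun n => (qs_bounds hx hirr n).2.2

theorem convergent_det (x : ℝ) (n : ℕ) :
    ps x n * qs x (n + 1) - ps x (n + 1) * qs x n = (-1) ^ n := by
  induction n with
  | zero => simp [ps, qs]
  | succ n ih =>
    simp only [ps, qs, pow_succ] at ih ⊢
    linear_combination -ih

theorem mul_convergent_denom {x : ℝ} (hirr : Irrational x) (n : ℕ) :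
    x * ((qs x (n + 1) : ℝ) + gauss^[n] x * qs x n) = ps x (n + 1) + gauss^[n] x * ps x n := by
  induction n with
  | zero => simp [ps, qs]
  | succ n ih =>
    have h := gauss_iterate_mul_add hirr n
    apply mul_left_cancel₀ (irrational_gauss_iterate hirr n).ne_zero
    simp only [ps, qs, Int.cast_add, Int.cast_mul] at ih ⊢
    linear_combination ih + (x * qs x (n + 1) - ps x (n + 1)) * h

/-- A number `x = (p + t p') / (q + t q')` with `t ∈ (0, 1)` and `p' q - p q' = ±1` lies between
`p / q` and `(p + p') / (q + q')`, at the indicated distances from them. -/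
theorem mobius_between {x t p p' q q' : ℝ} (hq : 0 < q) (hq' : 0 ≤ q') (ht0 : 0 < t)
    (ht1 : t < 1) (hdet : p' * q - p * q' = 1 ∨ p' * q - p * q' = -1)
    (hx : x * (q + t * q') = p + t * p') :
    x ∈ Set.Ioo (min (p / q) ((p + p') / (q + q'))) (max (p / q) ((p + p') / (q + q'))) ∧
      |x - p / q| = t / (q * (q + t * q')) ∧
      |x - (p + p') / (q + q')| = (1 - t) / ((q + t * q') * (q + q')) := by
  have hqt : 0 < q + t * q' := by positivity
  have hqq : 0 < q + q' := by positivity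
  have hx' : x = (p + t * p') / (q + t * q') := by rw [← hx]; field_simp
  have hA : x - p / q = (p' * q - p * q') * (t / (q * (q + t * q'))) := by
    rw [hx']; field_simp; ring
  have hB : x - (p + p') / (q + q') =
      -(p' * q - p * q') * ((1 - t) / ((q + t * q') * (q + q'))) := by
    rw [hx']; field_simp; ring
  have hA0 : 0 < t / (q * (q + t * q')) := by positivity
  have hB0 : 0 < (1 - t) / ((q + t * q') * (q + q')) :=
    div_pos (by linarith) (by positivity)
  rw [hA, hB]
  rcases hdet with h | h <;> rw [h] at hA hB ⊢
  · refine ⟨⟨min_lt_of_left_lt (by linarith), lt_max_of_lt_right (by linarith)⟩, ?_, ?_⟩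
    · rw [one_mul, abs_of_pos hA0]
    · rw [neg_one_mul, abs_neg, abs_of_pos hB0]
  · refine ⟨⟨min_lt_of_right_lt (by linarith), lt_max_of_lt_left (by linarith)⟩, ?_, ?_⟩
    · rw [neg_one_mul, abs_neg, abs_of_pos hA0]
    · rw [neg_neg, one_mul, abs_of_pos hB0]

theorem mem_Ibasic_and_dist_endpoints {x : ℝ} (hx : x ∈ Set.Ioo (0 : ℝ) 1) (hirr : Irrational x)
    (n : ℕ) :
    x ∈ Ibasic x n ∧
      |x - ps x (n + 1) / qs x (n + 1)| =
        gauss^[n] x / (qs x (n + 1) * (qs x (n + 1) + gauss^[n] x * qs x n)) ∧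
      |x - (ps x (n + 1) + ps x n) / (qs x (n + 1) + qs x n)| =
        (1 - gauss^[n] x) /
          ((qs x (n + 1) + gauss^[n] x * qs x n) * (qs x (n + 1) + qs x n)) := by
  obtain ⟨h0, h1, -⟩ := qs_bounds hx hirr n
  obtain ⟨ht0, ht1⟩ := gauss_iterate_mem_Ioo hx hirr n
  refine mobius_between (by exact_mod_cast h1) (by exact_mod_cast h0) ht0 ht1 ?_
    (mul_convergent_denom hirr n)
  have hdet := convergent_det x n
  rcases neg_one_pow_eq_or ℤ n with h | h <;> rw [h] at hdet
  · exact Or.inl (by exact_mod_cast hdet)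
  · exact Or.inr (by exact_mod_cast hdet)

theorem abs_le_dist_add_dist_of_mem {x h a b : ℝ} (hx : x ∈ Set.Ioo (min a b) (max a b))
    (hxh : x + h ∈ Set.Ioo (min a b) (max a b)) : |h| ≤ |x - a| + |x - b| := by
  simp only [Set.mem_Ioo] at hx hxh
  grind

theorem abs_le_of_mem_Ibasic {x h : ℝ} (hx : x ∈ Set.Ioo (0 : ℝ) 1) (hirr : Irrational x) {K : ℕ}
    (hK : x + h ∈ Ibasic x K) : |h| ≤ 2 / (qs x (K + 1) : ℝ) ^ 2 := by
  obtain ⟨hmem, hA, hB⟩ := mem_Ibasic_and_dist_endpoints hx hirr K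
  obtain ⟨h0, h1, -⟩ := qs_bounds hx hirr K
  obtain ⟨ht0, ht1⟩ := gauss_iterate_mem_Ioo hx hirr K
  have hq' : (0 : ℝ) ≤ qs x K := by exact_mod_cast h0
  have hq : (0 : ℝ) < qs x (K + 1) := by exact_mod_cast h1
  have hle : |h| ≤ |x - ps x (K + 1) / qs x (K + 1)| +
      |x - (ps x (K + 1) + ps x K) / (qs x (K + 1) + qs x K)| :=
    abs_le_dist_add_dist_of_mem hmem hK
  have hA' : gauss^[K] x / (qs x (K + 1) * (qs x (K + 1) + gauss^[K] x * qs x K)) ≤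
      1 / (qs x (K + 1) : ℝ) ^ 2 := by
    gcongr
    nlinarith [mul_nonneg ht0.le hq', mul_nonneg hq.le (mul_nonneg ht0.le hq')]
  have hB' : (1 - gauss^[K] x) /
      ((qs x (K + 1) + gauss^[K] x * qs x K) * (qs x (K + 1) + qs x K)) ≤
      1 / (qs x (K + 1) : ℝ) ^ 2 := by
    gcongr
    · linarith
    · nlinarith [mul_nonneg ht0.le hq', mul_nonneg hq.le (mul_nonneg ht0.le hq'),
        mul_nonneg hq.le hq', mul_nonneg (mul_nonneg ht0.le hq') hq']
  rw [hA, hB] at hle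
  calc |h| ≤ _ := hle
    _ ≤ 1 / (qs x (K + 1) : ℝ) ^ 2 + 1 / (qs x (K + 1) : ℝ) ^ 2 := add_le_add hA' hB'
    _ = _ := by ring

theorem dist_endpoint_le_of_notMem {x h a b : ℝ} (hx : x ∈ Set.Ioo (min a b) (max a b))
    (hxh : x + h ∉ Set.Ioo (min a b) (max a b)) : |x - a| ≤ |h| ∨ |x - b| ≤ |h| := by
  simp only [Set.mem_Ioo] at hx hxh
  grind

/-- The distance from `x` to its convergent `p_n / q_n` is at least `1 / (2 q_n q_{n+1})`. -/
theorem le_dist_convergent {x : ℝ} (hx : x ∈ Set.Ioo (0 : ℝ) 1) (hirr : Irrational x) (n : ℕ) :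
    1 / (2 * (qs x (n + 1) : ℝ) * qs x (n + 2)) ≤ |x - ps x (n + 1) / qs x (n + 1)| := by
  rw [(mem_Ibasic_and_dist_endpoints hx hirr n).2.1]
  obtain ⟨h0, h1, -⟩ := qs_bounds hx hirr n
  have h2 := (qs_bounds hx hirr (n + 1)).2.2
  obtain ⟨ht0, -⟩ := gauss_iterate_mem_Ioo hx hirr n
  obtain ⟨hs0, hs1⟩ := gauss_iterate_mem_Ioo hx hirr (n + 1)
  have hts := gauss_iterate_mul_add hirr n
  have hrec : (qs x (n + 2) : ℝ) = ⌊(gauss^[n] x)⁻¹⌋ * qs x (n + 1) + qs x n := by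
    simp [qs]
  have hq' : (0 : ℝ) ≤ qs x n := by exact_mod_cast h0
  have hq : (0 : ℝ) < qs x (n + 1) := by exact_mod_cast h1
  have hle : (qs x (n + 1) : ℝ) ≤ qs x (n + 2) := by exact_mod_cast h2
  have hkey : (qs x (n + 1) : ℝ) + gauss^[n] x * qs x n =
      gauss^[n] x * (qs x (n + 2) + gauss^[n + 1] x * qs x (n + 1)) := by
    rw [hrec]
    linear_combination -(qs x (n + 1) : ℝ) * hts
  have hr' : (0 : ℝ) < qs x (n + 2) := hq.trans_le hle
  have hr : (0 : ℝ) < qs x (n + 2) + gauss^[n + 1] x * qs x (n + 1) := by positivity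
  rw [hkey]
  calc 1 / (2 * (qs x (n + 1) : ℝ) * qs x (n + 2))
      ≤ 1 / (qs x (n + 1) * (qs x (n + 2) + gauss^[n + 1] x * qs x (n + 1))) := by
        apply one_div_le_one_div_of_le (by positivity)
        nlinarith [mul_le_mul_of_nonneg_left hle hq.le, mul_pos hq hq,
          mul_lt_mul_of_pos_right hs1 (mul_pos hq hq)]
    _ = _ := by field_simp

/-- If `a_{n+1} ≠ 1`, the distance from `x` to the endpoint `(p_n + p_{n-1}) / (q_n + q_{n-1})` is
at least `1 / (2 q_n q_{n+1})`. -/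
theorem le_dist_mediant_of_ne_one {x : ℝ} (hx : x ∈ Set.Ioo (0 : ℝ) 1) (hirr : Irrational x)
    {n : ℕ} (ha : ⌊(gauss^[n] x)⁻¹⌋ ≠ 1) :
    1 / (2 * (qs x (n + 1) : ℝ) * qs x (n + 2)) ≤
      |x - (ps x (n + 1) + ps x n) / (qs x (n + 1) + qs x n)| := by
  rw [(mem_Ibasic_and_dist_endpoints hx hirr n).2.2]
  obtain ⟨h0, h1, h2⟩ := qs_bounds hx hirr n
  have ha1 := one_le_partialQuotient hx hirr n
  obtain ⟨ht0, -⟩ := gauss_iterate_mem_Ioo hx hirr n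
  obtain ⟨hs0, hs1⟩ := gauss_iterate_mem_Ioo hx hirr (n + 1)
  have hts := gauss_iterate_mul_add hirr n
  have hrec : (qs x (n + 2) : ℝ) = ⌊(gauss^[n] x)⁻¹⌋ * qs x (n + 1) + qs x n := by
    simp [qs]
  have hq' : (0 : ℝ) ≤ qs x n := by exact_mod_cast h0
  have hq : (0 : ℝ) < qs x (n + 1) := by exact_mod_cast h1
  have hle : (qs x n : ℝ) ≤ qs x (n + 1) := by exact_mod_cast h2
  have ha2 : (2 : ℝ) ≤ ⌊(gauss^[n] x)⁻¹⌋ := by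
    have : (2 : ℤ) ≤ ⌊(gauss^[n] x)⁻¹⌋ := by lia
    exact_mod_cast this
  generalize gauss^[n + 1] x = s at *
  generalize (⌊(gauss^[n] x)⁻¹⌋ : ℝ) = a at *
  generalize gauss^[n] x = t at *
  generalize (qs x (n + 2) : ℝ) = r at *
  generalize (qs x (n + 1) : ℝ) = q at *
  generalize (qs x n : ℝ) = q' at *
  have hr : 0 < r := by rw [hrec]; positivity
  have hnum : 1 - t = t * (a - 1 + s) := by linear_combination -hts
  have hden : q + t * q' = t * (r + s * q) := by rw [hrec]; linear_combination -q * hts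
  rw [hnum, hden]
  have hrs : 0 < r + s * q := by positivity
  calc 1 / (2 * q * r) ≤ 1 / ((q + q') * r) := by
        apply one_div_le_one_div_of_le (by positivity)
        gcongr
        linarith
    _ ≤ (a - 1 + s) / ((r + s * q) * (q + q')) := by
        rw [div_le_div_iff₀ (by positivity) (by positivity)]
        have hsr : r + s * q ≤ (a - 1 + s) * r := by
          rw [hrec]
          nlinarith [mul_nonneg (sub_nonneg.2 ha2) hr.le, mul_nonneg hs0.le hq',
            mul_nonneg (mul_nonneg hs0.le hq.le) (by linarith : (0 : ℝ) ≤ a - 1)]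
        nlinarith [mul_le_mul_of_nonneg_right hsr (by positivity : 0 ≤ q + q')]
    _ = _ := by field_simp

/-- If `a_{n+1} = 1`, the endpoint `(p_n + p_{n-1}) / (q_n + q_{n-1})` is the next convergent. -/
theorem le_dist_mediant_of_eq_one {x : ℝ} (hx : x ∈ Set.Ioo (0 : ℝ) 1) (hirr : Irrational x)
    {n : ℕ} (ha : ⌊(gauss^[n] x)⁻¹⌋ = 1) :
    1 / (2 * (qs x (n + 2) : ℝ) * qs x (n + 3)) ≤
      |x - (ps x (n + 1) + ps x n) / (qs x (n + 1) + qs x n)| := by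
  simpa [ps, qs, ha] using le_dist_convergent hx hirr (n + 1)

theorem qs_reciprocal_antitone {x : ℝ} (hx : x ∈ Set.Ioo (0 : ℝ) 1) (hirr : Irrational x)
    {m n : ℕ} (hmn : m ≤ n) :
    1 / (2 * (qs x (n + 1) : ℝ) * qs x (n + 2)) ≤ 1 / (2 * (qs x (m + 1) : ℝ) * qs x (m + 2)) := by
  have h1 : (0 : ℝ) < qs x (m + 1) := by exact_mod_cast (qs_bounds hx hirr m).2.1
  have h2 : (0 : ℝ) < qs x (m + 2) := by exact_mod_cast (qs_bounds hx hirr (m + 1)).2.1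
  have h3 : (qs x (m + 1) : ℝ) ≤ qs x (n + 1) := by
    exact_mod_cast qs_monotone hx hirr (by lia)
  have h5 : (0 : ℝ) < qs x (n + 1) := h1.trans_le h3
  have h4 : (qs x (m + 2) : ℝ) ≤ qs x (n + 2) := by
    exact_mod_cast qs_monotone hx hirr (by lia)
  gcongr

theorem le_abs_of_notMem_Ibasic {x h : ℝ} (hx : x ∈ Set.Ioo (0 : ℝ) 1) (hirr : Irrational x)
    {n : ℕ} (hn : x + h ∉ Ibasic x n) :
    1 / (2 * (qs x (n + 2) : ℝ) * qs x (n + 3)) ≤ |h| := by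
  have hanti := qs_reciprocal_antitone hx hirr n.le_succ
  rcases dist_endpoint_le_of_notMem (mem_Ibasic_and_dist_endpoints hx hirr n).1 hn with hh | hh
  · exact hanti.trans ((le_dist_convergent hx hirr n).trans hh)
  · by_cases ha : ⌊(gauss^[n] x)⁻¹⌋ = 1
    · exact (le_dist_mediant_of_eq_one hx hirr ha).trans hh
    · exact hanti.trans ((le_dist_mediant_of_ne_one hx hirr ha).trans hh)

theorem le_abs_of_notMem_Ibasic_of_ne_one {x h : ℝ} (hx : x ∈ Set.Ioo (0 : ℝ) 1)
    (hirr : Irrational x) {n : ℕ} (hn : x + h ∉ Ibasic x n) (ha : ⌊(gauss^[n] x)⁻¹⌋ ≠ 1) :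
    1 / (2 * (qs x (n + 1) : ℝ) * qs x (n + 2)) ≤ |h| := by
  rcases dist_endpoint_le_of_notMem (mem_Ibasic_and_dist_endpoints hx hirr n).1 hn with hh | hh
  · exact (le_dist_convergent hx hirr n).trans hh
  · exact (le_dist_mediant_of_ne_one hx hirr ha).trans hh

/-- Bounds on `|h|` in terms of the level `K_h` with `x+h ∈ I_{K_h}(x)`, `x+h ∉ I_{K_h+1}(x)`:
always `1/(2q_{K+2}q_{K+3}) ≤ |h| ≤ 2/q_K²`; and if `a_k(x) = 1` for only finitely many `k`,
then for `|h|` small enough one has the stronger bound `1/(2q_{K+1}q_{K+2}) ≤ |h|`. -/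
theorem increment_size_bounds (x : ℝ) (hx : x ∈ Set.Ioo (0 : ℝ) 1) (hirr : Irrational x) :
    (∀ h : ℝ, h ≠ 0 → x + h ∈ Set.Ioo (0 : ℝ) 1 →
      ∀ K : ℕ, x + h ∈ Ibasic x K → x + h ∉ Ibasic x (K + 1) →
        1 / (2 * (qs x (K + 3) : ℝ) * (qs x (K + 4) : ℝ)) ≤ |h| ∧
        |h| ≤ 2 / (qs x (K + 1) : ℝ) ^ 2) ∧
    ({n : ℕ | ⌊(gauss^[n] x)⁻¹⌋ = (1 : ℤ)}.Finite →
      ∃ h₀ : ℝ, 0 < h₀ ∧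
        ∀ h : ℝ, h ≠ 0 → x + h ∈ Set.Ioo (0 : ℝ) 1 → |h| ≤ h₀ →
          ∀ K : ℕ, x + h ∈ Ibasic x K → x + h ∉ Ibasic x (K + 1) →
            1 / (2 * (qs x (K + 2) : ℝ) * (qs x (K + 3) : ℝ)) ≤ |h|) := by
  refine ⟨fun h _ _ K hK hK' =>
    ⟨le_abs_of_notMem_Ibasic hx hirr hK', abs_le_of_mem_Ibasic hx hirr hK⟩, fun hfin => ?_⟩
  obtain ⟨M, hM⟩ := hfin.bddAbove
  have h1 : (0 : ℝ) < qs x (M + 2) := by exact_mod_cast (qs_bounds hx hirr (M + 1)).2.1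
  have h2 : (0 : ℝ) < qs x (M + 3) := by exact_mod_cast (qs_bounds hx hirr (M + 2)).2.1
  have hpos : 0 < 1 / (2 * (qs x (M + 2) : ℝ) * qs x (M + 3)) := by positivity
  refine ⟨1 / (2 * (qs x (M + 2) : ℝ) * qs x (M + 3)) / 2, by positivity, ?_⟩
  intro h _ _ hle K _ hK'
  apply le_abs_of_notMem_Ibasic_of_ne_one hx hirr hK'
  intro ha
  have hKM : K + 1 ≤ M := hM ha
  have hlow := le_abs_of_notMem_Ibasic hx hirr hK'
  have hanti := qs_reciprocal_antitone hx hirr (show K + 2 ≤ M + 1 by lia)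
  linarith


end
end

section
/- For every irrational x ∈ (0,1), the series ∑_{k=0}^∞ β_{k−1}(x)·γ_k(x) converges if and only if the series ∑_{k=0}^∞ log(q_{k+1}(x))/q_k(x)^2 converges. -/
open Real

noncomputable section

/-- The denominators `q_n(x)` of the continued fraction convergents of `x`:
`q_0 = 1`, `q_1 = a_1 = ⌊1/x⌋`, and `q_{n+2} = a_{n+2} q_{n+1} + q_n`
where `a_i(x) = ⌊1/T^{i-1}(x)⌋`. -/
def qden (x : ℝ) : ℕ → ℤ
  | 0 => 1
  | 1 => ⌊x⁻¹⌋
  | n + 2 => ⌊(gauss^[n + 1] x)⁻¹⌋ * qden x (n + 1) + qden x n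

/-- `betaCF x k = β_{k−1}(x) = ∏_{j=0}^{k−1} T^j(x)`; in particular `betaCF x 0 = β_{−1} = 1`. -/
def betaCF (x : ℝ) (k : ℕ) : ℝ := ∏ j ∈ Finset.range k, gauss^[j] x

/-- `γ_k(x) = β_{k−1}(x) · log(1/T^k(x))`. -/
def gammaCF (x : ℝ) (k : ℕ) : ℝ := betaCF x k * Real.log (gauss^[k] x)⁻¹

theorem gauss_iterate_mem {x : ℝ} (hx : x ∈ Set.Ioo (0 : ℝ) 1) (hirr : Irrational x) (k : ℕ) :
    gauss^[k] x ∈ Set.Ioo (0 : ℝ) 1 ∧ Irrational (gauss^[k] x) := by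
  induction k with
  | zero => exact ⟨hx, hirr⟩
  | succ k ih =>
    obtain ⟨⟨h0, -⟩, h⟩ := ih
    rw [Function.iterate_succ_apply', gauss, if_neg h0.ne']
    have h_fract : Irrational (Int.fract (gauss^[k] x)⁻¹) := h.inv.sub_intCast _
    exact ⟨⟨(Int.fract_nonneg _).lt_of_ne h_fract.ne_zero.symm, Int.fract_lt_one _⟩, h_fract⟩

theorem one_le_floor_inv_gauss_iterate {x : ℝ} (hx : x ∈ Set.Ioo (0 : ℝ) 1) (hirr : Irrational x)
    (k : ℕ) : 1 ≤ ⌊(gauss^[k] x)⁻¹⌋ := by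
  obtain ⟨⟨h0, h1⟩, -⟩ := gauss_iterate_mem hx hirr k
  exact Int.le_floor.mpr (by simpa using (one_le_inv₀ h0).mpr h1.le)

theorem floor_inv_mul_add_gauss_iterate {x : ℝ} (hx : x ∈ Set.Ioo (0 : ℝ) 1) (hirr : Irrational x)
    (k : ℕ) :
    gauss^[k] x * (⌊(gauss^[k] x)⁻¹⌋ + gauss^[k + 1] x) = 1 := by
  obtain ⟨⟨h0, -⟩, -⟩ := gauss_iterate_mem hx hirr k
  rw [Function.iterate_succ_apply' gauss k x, gauss, if_neg h0.ne', Int.floor_add_fract,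
    mul_inv_cancel₀ h0.ne']

theorem betaCF_succ (x : ℝ) (k : ℕ) : betaCF x (k + 1) = betaCF x k * gauss^[k] x :=
  Finset.prod_range_succ _ _

theorem betaCF_pos {x : ℝ} (hx : x ∈ Set.Ioo (0 : ℝ) 1) (hirr : Irrational x) (k : ℕ) :
    0 < betaCF x k :=
  Finset.prod_pos fun j _ => (gauss_iterate_mem hx hirr j).1.1

theorem betaCF_succ_le {x : ℝ} (hx : x ∈ Set.Ioo (0 : ℝ) 1) (hirr : Irrational x) (k : ℕ) :
    betaCF x (k + 1) ≤ betaCF x k := by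
  rw [betaCF_succ]
  exact mul_le_of_le_one_right (betaCF_pos hx hirr k).le (gauss_iterate_mem hx hirr k).1.2.le

theorem one_le_qden_and_le_succ {x : ℝ} (hx : x ∈ Set.Ioo (0 : ℝ) 1) (hirr : Irrational x)
    (k : ℕ) : 1 ≤ qden x k ∧ qden x k ≤ qden x (k + 1) := by
  induction k with
  | zero => exact ⟨le_rfl, one_le_floor_inv_gauss_iterate hx hirr 0⟩
  | succ k ih =>
    refine ⟨ih.1.trans ih.2, ?_⟩
    have ha := one_le_floor_inv_gauss_iterate hx hirr (k + 1)
    rw [qden]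
    nlinarith [ih.1, ih.2]

theorem qden_add_le {x : ℝ} (hx : x ∈ Set.Ioo (0 : ℝ) 1) (hirr : Irrational x) (k : ℕ) :
    qden x (k + 1) + qden x k ≤ qden x (k + 2) := by
  have ha := one_le_floor_inv_gauss_iterate hx hirr (k + 1)
  have hq := (one_le_qden_and_le_succ hx hirr (k + 1)).1
  rw [qden]
  nlinarith

theorem qden_mul_betaCF_add {x : ℝ} (hx : x ∈ Set.Ioo (0 : ℝ) 1) (hirr : Irrational x) (k : ℕ) :
    (qden x (k + 1) : ℝ) * betaCF x (k + 1) + qden x k * betaCF x (k + 2) = 1 := by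
  induction k with
  | zero =>
    have h := floor_inv_mul_add_gauss_iterate hx hirr 0
    simp only [Function.iterate_zero, id_eq] at h
    simp only [betaCF, qden, Finset.prod_range_succ, Finset.prod_range_zero,
      Function.iterate_zero, id_eq]
    push_cast
    linear_combination h
  | succ k ih =>
    have h := floor_inv_mul_add_gauss_iterate hx hirr (k + 1)
    rw [betaCF_succ x (k + 2), qden]
    rw [betaCF_succ x (k + 1)] at ih ⊢
    push_cast
    linear_combination ih + (qden x (k + 1) : ℝ) * betaCF x (k + 1) * h

theorem qden_mul_betaCF_mem {x : ℝ} (hx : x ∈ Set.Ioo (0 : ℝ) 1) (hirr : Irrational x) (k : ℕ) :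
    (qden x k : ℝ) * betaCF x k ∈ Set.Icc (1 / 2 : ℝ) 1 := by
  cases k with
  | zero => norm_num [qden, betaCF]
  | succ k =>
    have h := qden_mul_betaCF_add hx hirr k
    obtain ⟨h1, h2⟩ := one_le_qden_and_le_succ hx hirr k
    have h1' : (1 : ℝ) ≤ qden x k := by exact_mod_cast h1
    have h2' : (qden x k : ℝ) ≤ qden x (k + 1) := by exact_mod_cast h2
    have hb := betaCF_pos hx hirr (k + 2)
    have hmul := mul_le_mul h2' (betaCF_succ_le hx hirr (k + 1)) hb.le (by linarith)
    have hpos : 0 ≤ (qden x k : ℝ) * betaCF x (k + 2) := by positivity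
    exact ⟨by linarith, by linarith⟩

theorem pow_le_qden {x : ℝ} (hx : x ∈ Set.Ioo (0 : ℝ) 1) (hirr : Irrational x) (k : ℕ) :
    2 / 3 * (3 / 2 : ℝ) ^ k ≤ qden x k := by
  induction k using Nat.twoStepInduction with
  | zero => norm_num [qden]
  | one =>
    have h : (1 : ℝ) ≤ qden x 1 := by exact_mod_cast (one_le_qden_and_le_succ hx hirr 1).1
    linarith
  | more k h0 h1 =>
    have h : (qden x (k + 1) : ℝ) + qden x k ≤ qden x (k + 2) := by
      exact_mod_cast qden_add_le hx hirr k
    have hp : (0 : ℝ) < (3 / 2) ^ k := by positivity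
    rw [pow_succ] at h1 ⊢
    rw [pow_succ]
    linarith

theorem summable_inv_qden {x : ℝ} (hx : x ∈ Set.Ioo (0 : ℝ) 1) (hirr : Irrational x) :
    Summable fun k : ℕ => (qden x k : ℝ)⁻¹ := by
  have hgeom : Summable fun k : ℕ => 3 / 2 * (2 / 3 : ℝ) ^ k :=
    (summable_geometric_of_lt_one (by norm_num) (by norm_num)).mul_left _
  refine Summable.of_nonneg_of_le (fun k => ?_) (fun k => ?_) hgeom
  · have h : (1 : ℝ) ≤ qden x k := by exact_mod_cast (one_le_qden_and_le_succ hx hirr k).1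
    positivity
  · refine (inv_anti₀ (by positivity) (pow_le_qden hx hirr k)).trans_eq ?_
    rw [mul_inv, ← inv_pow]
    norm_num

theorem log_inv_gauss_iterate_le {x : ℝ} (hx : x ∈ Set.Ioo (0 : ℝ) 1) (hirr : Irrational x)
    (k : ℕ) : Real.log (gauss^[k] x)⁻¹ ≤ 1 + Real.log (qden x (k + 1)) := by
  obtain ⟨⟨ht0, ht1⟩, -⟩ := gauss_iterate_mem hx hirr k
  have hq : (1 : ℝ) ≤ qden x (k + 1) := by
    exact_mod_cast (one_le_qden_and_le_succ hx hirr (k + 1)).1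
  have hb : betaCF x k ≤ 1 := Finset.prod_le_one
    (fun j _ => (gauss_iterate_mem hx hirr j).1.1.le)
    (fun j _ => (gauss_iterate_mem hx hirr j).1.2.le)
  have hle : (gauss^[k] x)⁻¹ ≤ 2 * qden x (k + 1) := by
    rw [inv_le_iff_one_le_mul₀ ht0]
    have h := (qden_mul_betaCF_mem hx hirr (k + 1)).1
    rw [betaCF_succ] at h
    have := mul_le_mul_of_nonneg_left (mul_le_of_le_one_left ht0.le hb) (zero_le_one.trans hq)
    linarith
  have hlog := Real.log_le_log (inv_pos.mpr ht0) hle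
  rw [Real.log_mul two_ne_zero (by positivity)] at hlog
  linarith [Real.log_two_lt_d9]

theorem log_qden_succ_le {x : ℝ} (hx : x ∈ Set.Ioo (0 : ℝ) 1) (hirr : Irrational x) (k : ℕ) :
    Real.log (qden x (k + 1)) ≤ Real.log (gauss^[k] x)⁻¹ + qden x k := by
  obtain ⟨⟨ht0, ht1⟩, -⟩ := gauss_iterate_mem hx hirr k
  have hq : (1 : ℝ) ≤ qden x k := by exact_mod_cast (one_le_qden_and_le_succ hx hirr k).1
  have hq' : (1 : ℝ) ≤ qden x (k + 1) := by
    exact_mod_cast (one_le_qden_and_le_succ hx hirr (k + 1)).1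
  have hle : (qden x (k + 1) : ℝ) ≤ 2 * qden x k * (gauss^[k] x)⁻¹ := by
    rw [← div_eq_mul_inv, le_div_iff₀ ht0]
    have h0 := (qden_mul_betaCF_mem hx hirr k).1
    have h1 := (qden_mul_betaCF_mem hx hirr (k + 1)).2
    rw [betaCF_succ] at h1
    refine le_of_mul_le_mul_right ?_ (betaCF_pos hx hirr k)
    linarith
  have hlog := Real.log_le_log (by positivity) hle
  rw [Real.log_mul (by positivity) (by positivity), Real.log_mul two_ne_zero (by positivity)]
    at hlog
  linarith [Real.log_two_lt_d9, Real.log_le_sub_one_of_pos (show (0 : ℝ) < qden x k by linarith)]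

/-- For irrational `x ∈ (0,1)`, `∑ β_{k−1}(x)γ_k(x)` converges iff
`∑ log(q_{k+1}(x))/q_k(x)²` converges. -/
theorem summable_beta_gamma_iff (x : ℝ) (hx : x ∈ Set.Ioo (0 : ℝ) 1) (hirr : Irrational x) :
    (Summable fun k : ℕ => betaCF x k * gammaCF x k) ↔
      Summable fun k : ℕ => Real.log ((qden x (k + 1) : ℝ)) / (qden x k : ℝ) ^ 2 := by
  have hq (k : ℕ) : (1 : ℝ) ≤ qden x k := by
    exact_mod_cast (one_le_qden_and_le_succ hx hirr k).1
  have hlog (k : ℕ) : 0 ≤ Real.log (gauss^[k] x)⁻¹ := by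
    obtain ⟨⟨h0, h1⟩, -⟩ := gauss_iterate_mem hx hirr k
    exact Real.log_nonneg ((one_le_inv₀ h0).mpr h1.le)
  constructor
  · intro h
    refine Summable.of_nonneg_of_le (fun k => ?_) (fun k => ?_)
      ((h.mul_left 4).add (summable_inv_qden hx hirr))
    · exact div_nonneg (Real.log_nonneg (hq _)) (sq_nonneg _)
    · have hpos : (0 : ℝ) < qden x k := zero_lt_one.trans_le (hq k)
      have hsq : 1 ≤ 4 * ((qden x k : ℝ) * betaCF x k) ^ 2 := by
        nlinarith [(qden_mul_betaCF_mem hx hirr k).1]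
      rw [div_le_iff₀ (by positivity), gammaCF]
      calc Real.log (qden x (k + 1))
          ≤ Real.log (gauss^[k] x)⁻¹ + qden x k := log_qden_succ_le hx hirr k
        _ ≤ 4 * ((qden x k : ℝ) * betaCF x k) ^ 2 * Real.log (gauss^[k] x)⁻¹ + qden x k := by
            gcongr
            exact le_mul_of_one_le_left (hlog k) hsq
        _ = _ := by field_simp
  · intro h
    refine Summable.of_nonneg_of_le (fun k => ?_) (fun k => ?_)
      (h.add (summable_inv_qden hx hirr))
    · have hb := betaCF_pos hx hirr k
      exact mul_nonneg hb.le (mul_nonneg hb.le (hlog k))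
    · have hpos : (0 : ℝ) < qden x k := zero_lt_one.trans_le (hq k)
      have hb := betaCF_pos hx hirr k
      have hsq : ((qden x k : ℝ) * betaCF x k) ^ 2 ≤ 1 :=
        pow_le_one₀ (by positivity) (qden_mul_betaCF_mem hx hirr k).2
      refine le_of_mul_le_mul_right ?_ (show (0 : ℝ) < (qden x k : ℝ) ^ 2 by positivity)
      calc betaCF x k * gammaCF x k * (qden x k : ℝ) ^ 2
          = ((qden x k : ℝ) * betaCF x k) ^ 2 * Real.log (gauss^[k] x)⁻¹ := by
            rw [gammaCF]; ring
        _ ≤ Real.log (gauss^[k] x)⁻¹ := mul_le_of_le_one_left (hlog k) hsq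
        _ ≤ 1 + Real.log (qden x (k + 1)) := log_inv_gauss_iterate_le hx hirr k
        _ ≤ qden x k + Real.log (qden x (k + 1)) := by gcongr; exact hq k
        _ = _ := by field_simp; ring

end
end
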